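/- arXiv:2502.12781 — 4 statements merged into one kernel-verified Lean document; each statement's English description precedes it below -/
import Mathlib

section
/- Let G be a simple graph on n vertices with adjacency matrix A(G), and let τ(G;x) = d₂(xIₙ − A(G)) be its second immanantal polynomial. Then the derivative of τ satisfies τ'(G;x) = Σ_{u=1}^n det[(xIₙ − A(G))_u^u] + Σ_{u=1}^n d₂[(xIₙ − A(G))_u^u], where (xIₙ − A(G))_u^u denotes the submatrix of xIₙ − A(G) obtained by deleting row u and column u. -/
open Matrix Finset Polynomial

/-- The second immanant `d₂(M) = Σ_i M i i * det (M(i)) - det M`, where `M(i)` is the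
submatrix of `M` obtained by deleting row `i` and column `i`. -/
noncomputable def d2 {α : Type*} [Fintype α] [DecidableEq α] {R : Type*} [CommRing R]
    (M : Matrix α α R) : R :=
  (∑ i, M i i *
    (M.submatrix (fun k : {k : α // k ≠ i} => (k : α))
      (fun k : {k : α // k ≠ i} => (k : α))).det) - M.det

open Classical in
/-- The characteristic-type matrix `x Iₙ - A(G)` of a simple graph `G`, as a matrix of real
polynomials, where `A(G)` is the 0-1 adjacency matrix of `G`. -/
noncomputable def charMat {V : Type*} [Fintype V] (G : SimpleGraph V) :
    Matrix V V (Polynomial ℝ) :=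
  Matrix.diagonal (fun _ => (X : Polynomial ℝ)) -
    Matrix.of (fun i j => if G.Adj i j then (1 : Polynomial ℝ) else 0)

open Classical in
/-- The second immanantal polynomial `τ(G; x) = d₂(x Iₙ - A(G))` of a simple graph `G`. -/
noncomputable def tau {V : Type*} [Fintype V] (G : SimpleGraph V) : Polynomial ℝ :=
  d2 (charMat G)

/-- If a row of `M` is replaced by the corresponding standard basis vector, the determinant becomes
the principal minor at that row. -/
theorem det_updateRow_single_eq_det_submatrix {α R : Type*} [Fintype α] [DecidableEq α]
    [CommRing R] (M : Matrix α α R) (u : α) :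
    (M.updateRow u (Pi.single u 1)).det =
      (M.submatrix (fun k : {k : α // k ≠ u} => (k : α))
        (fun k : {k : α // k ≠ u} => (k : α))).det := by
  rw [Matrix.twoBlockTriangular_det _ (fun k => k ≠ u)]
  · have h1 : (Matrix.toSquareBlockProp (M.updateRow u (Pi.single u 1))
        (fun k => ¬ k ≠ u)) = 1 := by
      ext ⟨i, hi⟩ ⟨j, hj⟩
      obtain rfl := not_not.mp hi
      obtain rfl := not_not.mp hj
      simp [Matrix.toSquareBlockProp]
    have h2 : Matrix.toSquareBlockProp (M.updateRow u (Pi.single u 1)) (fun k => k ≠ u) =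
        M.submatrix (fun k : {k : α // k ≠ u} => (k : α))
          (fun k : {k : α // k ≠ u} => (k : α)) := by
      ext ⟨i, hi⟩ ⟨j, hj⟩
      simp [Matrix.toSquareBlockProp, Matrix.updateRow_ne hi]
    rw [h1, h2, Matrix.det_one, mul_one]
  · intro i hi j hj
    obtain rfl := not_not.mp hi
    simp [hj]

/-- The derivative of a determinant is obtained by differentiating one row at a time. -/
theorem derivative_det_eq_sum_updateRow {α R : Type*} [Fintype α] [DecidableEq α]
    [CommRing R] (M : Matrix α α R[X]) :
    derivative M.det = ∑ u, (M.updateRow u (fun j => derivative (M u j))).det := by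
  simp_rw [← Matrix.det_transpose M, ← Matrix.det_transpose (M.updateRow _ _),
    Matrix.det_apply, derivative_sum]
  rw [Finset.sum_comm]
  refine Finset.sum_congr rfl fun σ _ => ?_
  rw [Units.smul_def, derivative_smul, derivative_prod_finset, Finset.smul_sum]
  refine Finset.sum_congr rfl fun u _ => ?_
  rw [Units.smul_def, ← Finset.prod_erase_mul _ _ (Finset.mem_univ u)]
  congr 2
  · refine Finset.prod_congr rfl fun i hi => ?_
    simp [Matrix.updateRow_ne (Finset.ne_of_mem_erase hi)]
  · simp

/-- Jacobi's formula for a matrix whose entrywise derivative is the identity. -/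
theorem derivative_det_eq_sum_minors {α R : Type*} [Fintype α] [DecidableEq α]
    [CommRing R] (M : Matrix α α R[X])
    (hM : ∀ i j, derivative (M i j) = (1 : Matrix α α R[X]) i j) :
    derivative M.det =
      ∑ u, (M.submatrix (fun k : {k : α // k ≠ u} => (k : α))
        (fun k : {k : α // k ≠ u} => (k : α))).det := by
  rw [derivative_det_eq_sum_updateRow]
  refine Finset.sum_congr rfl fun u _ => ?_
  rw [← det_updateRow_single_eq_det_submatrix]
  congr 2
  ext1 j
  rw [hM, Matrix.one_apply, Pi.single_apply]
  simp only [eq_comm]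

/-- Deleting two indices in either order gives the same principal minor. -/
theorem det_submatrix_submatrix_comm {α R : Type*} [Fintype α] [DecidableEq α]
    [CommRing R] (M : Matrix α α R) {u v : α} (huv : u ≠ v) :
    ((M.submatrix (fun k : {k : α // k ≠ u} => (k : α))
        (fun k : {k : α // k ≠ u} => (k : α))).submatrix
      (fun k : {k : {k : α // k ≠ u} // k ≠ ⟨v, huv.symm⟩} => (k : {k : α // k ≠ u}))
      (fun k : {k : {k : α // k ≠ u} // k ≠ ⟨v, huv.symm⟩} => (k : {k : α // k ≠ u}))).det =
    ((M.submatrix (fun k : {k : α // k ≠ v} => (k : α))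
        (fun k : {k : α // k ≠ v} => (k : α))).submatrix
      (fun k : {k : {k : α // k ≠ v} // k ≠ ⟨u, huv⟩} => (k : {k : α // k ≠ v}))
      (fun k : {k : {k : α // k ≠ v} // k ≠ ⟨u, huv⟩} => (k : {k : α // k ≠ v}))).det := by
  let e : {k : {k : α // k ≠ u} // k ≠ ⟨v, huv.symm⟩} ≃
      {k : {k : α // k ≠ v} // k ≠ ⟨u, huv⟩} :=
    { toFun := fun k => ⟨⟨k.1.1, fun h => k.2 (Subtype.ext h)⟩,
        fun h => k.1.2 (congrArg Subtype.val h)⟩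
      invFun := fun k => ⟨⟨k.1.1, fun h => k.2 (Subtype.ext h)⟩,
        fun h => k.1.2 (congrArg Subtype.val h)⟩
      left_inv := fun _ => rfl
      right_inv := fun _ => rfl }
  rw [← Matrix.det_submatrix_equiv_self e]
  rfl

/-- The derivative of the second immanant of a matrix whose entrywise derivative is the identity. -/
theorem derivative_d2 {α R : Type*} [Fintype α] [DecidableEq α] [CommRing R]
    (M : Matrix α α R[X]) (hM : ∀ i j, derivative (M i j) = (1 : Matrix α α R[X]) i j) :
    derivative (d2 M) =
      (∑ u, (M.submatrix (fun k : {k : α // k ≠ u} => (k : α))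
        (fun k : {k : α // k ≠ u} => (k : α))).det) +
      ∑ u, d2 (M.submatrix (fun k : {k : α // k ≠ u} => (k : α))
        (fun k : {k : α // k ≠ u} => (k : α))) := by
  have hsub (u : α) := derivative_det_eq_sum_minors
    (M.submatrix (fun k : {k : α // k ≠ u} => (k : α)) (fun k : {k : α // k ≠ u} => (k : α)))
    (fun i j => by simp [hM, Matrix.one_apply, Subtype.ext_iff])
  simp only [d2, derivative_sub, derivative_sum, derivative_mul, hsub,
    derivative_det_eq_sum_minors M hM, hM, Matrix.one_apply_eq, one_mul,
    Finset.sum_add_distrib, Finset.sum_sub_distrib, Finset.mul_sum, add_sub_assoc]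
  refine congrArg (_ + ·) (congrArg (· - _) ?_)
  rw [Finset.sum_sigma', Finset.sum_sigma']
  refine Finset.sum_bij' (fun p _ => ⟨p.2.1, ⟨p.1, p.2.2.symm⟩⟩)
    (fun p _ => ⟨p.2.1, ⟨p.1, p.2.2.symm⟩⟩) (by simp) (by simp) (by simp) (by simp) ?_
  rintro ⟨u, v, hv⟩ -
  rw [det_submatrix_submatrix_comm M hv.symm]
  rfl

open Classical in
/-- For a simple graph `G` on `n` vertices with second immanantal polynomial
`τ(G;x) = d₂(x Iₙ - A(G))`, the derivative of `τ` satisfies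
`τ'(G;x) = Σ_u det[(x Iₙ - A(G))_u^u] + Σ_u d₂[(x Iₙ - A(G))_u^u]`. -/
theorem derivative_tau {n : ℕ} (G : SimpleGraph (Fin n)) :
    Polynomial.derivative (tau G)
      = (∑ u : Fin n,
          ((charMat G).submatrix (fun k : {k : Fin n // k ≠ u} => (k : Fin n))
            (fun k : {k : Fin n // k ≠ u} => (k : Fin n))).det)
        + ∑ u : Fin n,
          d2 ((charMat G).submatrix (fun k : {k : Fin n // k ≠ u} => (k : Fin n))
            (fun k : {k : Fin n // k ≠ u} => (k : Fin n))) := by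
  have hM (i j : Fin n) : derivative (charMat G i j) =
      (1 : Matrix (Fin n) (Fin n) ℝ[X]) i j := by
    rw [charMat, Matrix.sub_apply, Matrix.of_apply, derivative_sub]
    rcases eq_or_ne i j with rfl | hij
    · simp
    · simp [hij, apply_ite derivative]
  convert derivative_d2 (charMat G) hM
  unfold tau
  congr!
end

section
/- Let G be a simple graph on n vertices with adjacency matrix A(G). For an index i with 1 ≤ i ≤ n, let xIₙ^{(i)} denote the diagonal matrix xIₙ with its i-th diagonal entry replaced by 0. Then d₂(xIₙ^{(i)} − A(G)) = d₂(xIₙ − A(G)) − x·det[(xIₙ − A(G))_i^i] − x·d₂[(xIₙ − A(G))_i^i], where (xIₙ − A(G))_i^i is the submatrix of xIₙ − A(G) obtained by deleting row i and column i. -/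
open Matrix Finset Polynomial

/-- Subtracting `t` from the `i`-th diagonal entry lowers the determinant by `t` times the
principal minor at `i`. -/
theorem det_sub_single_diag {α : Type*} [Fintype α] [DecidableEq α] {R : Type*} [CommRing R]
    (M : Matrix α α R) (i : α) (t : R) :
    (M - Matrix.single i i t).det = M.det - t *
      (M.submatrix (fun k : {k : α // k ≠ i} => (k : α))
        (fun k : {k : α // k ≠ i} => (k : α))).det := by
  have hrow : M - Matrix.single i i t = M.updateRow i (M i + (-t) • Pi.single i 1) := by
    ext a b
    by_cases ha : a = i
    · subst ha
      by_cases hb : b = a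
      · subst hb
        simp [sub_eq_add_neg]
      · simp [hb, Ne.symm hb]
    · simp [ha, Ne.symm ha]
  have hminor : (M.updateRow i (Pi.single i 1)).det =
      (M.submatrix (fun k : {k : α // k ≠ i} => (k : α))
        (fun k : {k : α // k ≠ i} => (k : α))).det := by
    rw [Matrix.twoBlockTriangular_det' _ (fun k => k = i)
      (by rintro a rfl b hb; simp [hb])]
    have hone : Matrix.toSquareBlockProp (M.updateRow i (Pi.single i 1))
        (fun k => k = i) = 1 := by
      ext ⟨a, rfl⟩ ⟨b, rfl⟩
      simp [Matrix.toSquareBlockProp]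
    rw [hone, @Matrix.det_one _ _ (Subtype.fintype fun k => k = i), one_mul]
    congr 1
    ext a b
    exact congrFun (Matrix.updateRow_ne (M := M) (b := Pi.single i 1) a.2) b
  rw [hrow, Matrix.det_updateRow_add, Matrix.det_updateRow_smul, Matrix.updateRow_eq_self, hminor]
  ring

/-- Removing two distinct elements of a type in either order gives equivalent subtypes. -/
def subtypeNeSwap {α : Type*} {i k : α} (h : i ≠ k) :
    {l : {l : α // l ≠ k} // l ≠ ⟨i, h⟩} ≃ {l : {l : α // l ≠ i} // l ≠ ⟨k, h.symm⟩} where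
  toFun l := ⟨⟨l, fun e => l.2 (Subtype.ext e)⟩, fun e => l.1.2 (congrArg Subtype.val e)⟩
  invFun l := ⟨⟨l, fun e => l.2 (Subtype.ext e)⟩, fun e => l.1.2 (congrArg Subtype.val e)⟩
  left_inv _ := rfl
  right_inv _ := rfl

/-- The effect on the second immanant of subtracting `t` from a diagonal entry. -/
theorem d2_sub_single_diag {α : Type*} [Fintype α] [DecidableEq α] {R : Type*} [CommRing R]
    (M : Matrix α α R) (i : α) (t : R) :
    d2 (M - Matrix.single i i t) = d2 M
      - t * (M.submatrix (fun k : {k : α // k ≠ i} => (k : α))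
          (fun k : {k : α // k ≠ i} => (k : α))).det
      - t * d2 (M.submatrix (fun k : {k : α // k ≠ i} => (k : α))
          (fun k : {k : α // k ≠ i} => (k : α))) := by
  have hi : (M - Matrix.single i i t).submatrix (fun k : {k : α // k ≠ i} => (k : α))
      (fun k : {k : α // k ≠ i} => (k : α)) =
      M.submatrix (fun k : {k : α // k ≠ i} => (k : α))
        (fun k : {k : α // k ≠ i} => (k : α)) := by
    ext a b
    simp [Ne.symm a.2]
  have hk (k : {k : α // k ≠ i}) :
      (M - Matrix.single i i t) k k * ((M - Matrix.single i i t).submatrix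
        (fun l : {l : α // l ≠ (k : α)} => (l : α))
        (fun l : {l : α // l ≠ (k : α)} => (l : α))).det =
      M k k * (M.submatrix (fun l : {l : α // l ≠ (k : α)} => (l : α))
        (fun l : {l : α // l ≠ (k : α)} => (l : α))).det
      - t * (M k k * ((M.submatrix (fun l : {l : α // l ≠ i} => (l : α))
          (fun l : {l : α // l ≠ i} => (l : α))).submatrix
        (fun l : {l : {l : α // l ≠ i} // l ≠ k} => (l : {l : α // l ≠ i}))
        (fun l : {l : {l : α // l ≠ i} // l ≠ k} => (l : {l : α // l ≠ i}))).det) := by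
    have hsub : (M - Matrix.single i i t).submatrix
        (fun l : {l : α // l ≠ (k : α)} => (l : α))
        (fun l : {l : α // l ≠ (k : α)} => (l : α)) =
        M.submatrix (fun l : {l : α // l ≠ (k : α)} => (l : α))
          (fun l : {l : α // l ≠ (k : α)} => (l : α)) -
        Matrix.single ⟨i, k.2.symm⟩ ⟨i, k.2.symm⟩ t := by
      ext a b
      simp [Matrix.single_apply, Subtype.ext_iff]
    rw [hsub, det_sub_single_diag,
      ← Matrix.det_submatrix_equiv_self (subtypeNeSwap k.2.symm)
        ((M.submatrix (fun l : {l : α // l ≠ i} => (l : α))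
          (fun l : {l : α // l ≠ i} => (l : α))).submatrix _ _)]
    simp only [Matrix.submatrix_submatrix, Matrix.sub_apply, Matrix.single_apply,
      Ne.symm k.2, false_and, if_false, sub_zero]
    rw [mul_sub, mul_left_comm]
    rfl
  unfold d2
  rw [det_sub_single_diag, Fintype.sum_eq_add_sum_subtype_ne _ i,
    Fintype.sum_eq_add_sum_subtype_ne (fun k => M k k * _) i, hi, Finset.sum_congr rfl
      (fun k _ => hk k), Finset.sum_sub_distrib, ← Finset.mul_sum]
  simp only [Matrix.sub_apply, Matrix.single_apply_same, Matrix.submatrix_apply]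
  ring

open Classical in
/-- For a simple graph `G` on `n` vertices with adjacency matrix `A(G)` and
`x Iₙ^(i)` the diagonal matrix `x Iₙ` with its `i`-th diagonal entry replaced by `0`:
`d₂(x Iₙ^(i) - A(G)) = d₂(x Iₙ - A(G)) - x · det[(x Iₙ - A(G))_i^i]
  - x · d₂[(x Iₙ - A(G))_i^i]`. -/
theorem d2_zero_diagonal_entry {n : ℕ} (G : SimpleGraph (Fin n)) (i : Fin n) :
    d2 (Matrix.diagonal (fun k : Fin n => if k = i then (0 : Polynomial ℝ) else X) -
          Matrix.of (fun a b => if G.Adj a b then (1 : Polynomial ℝ) else 0))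
      = d2 (charMat G)
        - X * ((charMat G).submatrix (fun k : {k : Fin n // k ≠ i} => (k : Fin n))
            (fun k : {k : Fin n // k ≠ i} => (k : Fin n))).det
        - X * d2 ((charMat G).submatrix (fun k : {k : Fin n // k ≠ i} => (k : Fin n))
            (fun k : {k : Fin n // k ≠ i} => (k : Fin n))) := by
  rw [← d2_sub_single_diag]
  congr 1
  ext1 a b
  by_cases hab : a = b
  · subst hab
    by_cases ha : a = i
    · subst ha
      simp [charMat]
    · simp [charMat, ha, Ne.symm ha]
  · have : ¬(i = a ∧ i = b) := fun h => hab (h.1.symm.trans h.2)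
    simp [charMat, hab, this]
end

section
/- Let A be the adjacency matrix of a loopless digraph on n vertices (an n×n real 0-1 matrix with zero diagonal), let D = diag(d⁻(v_1),…,d⁻(v_n)) be the diagonal matrix of in-degrees, where d⁻(v_j) = Σ_i A_{ij}, and fix η ∈ {0,1} and α ∈ {−1,1}. Let g(x) = d₂(xIₙ − ηD − αA). Then the derivative of g satisfies g'(x) = Σ_{u=1}^n det[(xIₙ − ηD − αA)_u^u] + Σ_{u=1}^n d₂[(xIₙ − ηD − αA)_u^u], where M_u^u denotes the submatrix of M obtained by deleting row u and column u. -/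
open Matrix Finset Polynomial

/-- The matrix `x Iₙ - η D - α A` of real polynomials, where `A` is the adjacency matrix of a
loopless digraph and `D = diag(d⁻(v_1), …, d⁻(v_n))` is its diagonal matrix of in-degrees
`d⁻(v_j) = Σ_i A i j`. -/
noncomputable def gMat (η α : ℝ) {n : ℕ} (A : Matrix (Fin n) (Fin n) ℝ) :
    Matrix (Fin n) (Fin n) (Polynomial ℝ) :=
  Matrix.diagonal (fun _ => (X : Polynomial ℝ))
    - Polynomial.C η • (Matrix.diagonal (fun j => ∑ i, A i j)).map Polynomial.C
    - Polynomial.C α • A.map Polynomial.C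

/-- The polynomial `g(x) = d₂(x Iₙ - η D - α A)`. -/
noncomputable def gPoly (η α : ℝ) {n : ℕ} (A : Matrix (Fin n) (Fin n) ℝ) : Polynomial ℝ :=
  d2 (gMat η α A)

/-- The determinant of `M` with column `u` replaced by the `u`-th unit vector is the principal
minor obtained by deleting row and column `u`. -/
theorem det_updateCol_single_one {ι R : Type*} [Fintype ι] [DecidableEq ι] [CommRing R]
    (M : Matrix ι ι R) (u : ι) :
    (M.updateCol u (Pi.single u 1)).det
      = (M.submatrix (fun k : {k : ι // k ≠ u} => (k : ι))
          (fun k : {k : ι // k ≠ u} => (k : ι))).det := by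
  rw [twoBlockTriangular_det' _ (fun k => k ≠ u)]
  · have h : (toSquareBlockProp (M.updateCol u (Pi.single u 1)) fun k => ¬k ≠ u) = 1 := by
      ext ⟨i, hi⟩ ⟨j, hj⟩
      obtain rfl := not_not.mp hi
      obtain rfl := not_not.mp hj
      simp [toSquareBlockProp]
    rw [h, det_one, mul_one]
    congr 1
    ext ⟨i, hi⟩ ⟨j, hj⟩
    simp [toSquareBlockProp, updateCol_ne hj]
  · intro i hi j hj
    obtain rfl := not_not.mp hj
    simp [hi]

/-- Jacobi's formula for a polynomial matrix whose entrywise derivative is the identity. -/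
theorem derivative_det_of_map_derivative_eq_one {ι R : Type*} [Fintype ι] [DecidableEq ι]
    [CommRing R] (M : Matrix ι ι R[X]) (hM : M.map derivative = 1) :
    derivative M.det
      = ∑ u, (M.submatrix (fun k : {k : ι // k ≠ u} => (k : ι))
          (fun k : {k : ι // k ≠ u} => (k : ι))).det := by
  have hM' (i j : ι) : derivative (M i j) = (1 : Matrix ι ι R[X]) i j := congrFun₂ hM i j
  simp_rw [← det_updateCol_single_one, det_apply', derivative_sum]
  rw [Finset.sum_comm]
  refine Finset.sum_congr rfl fun σ _ => ?_
  rw [← Finset.mul_sum, derivative_intCast_mul, derivative_prod_finset]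
  congr 1
  refine Finset.sum_congr rfl fun u _ => ?_
  rw [← Finset.prod_erase_mul _ _ (Finset.mem_univ u), hM', updateCol_self, one_apply,
    Pi.single_apply]
  congr 1
  refine Finset.prod_congr rfl fun k hk => ?_
  rw [updateCol_ne (Finset.ne_of_mem_erase hk)]

/-- Deleting two indices from a finite type in either order gives equivalent subtypes. -/
def deleteTwoEquiv {ι : Type*} (i u : ι) (hu : u ≠ i) :
    {k : {k : ι // k ≠ i} // k ≠ ⟨u, hu⟩} ≃ {k : {k : ι // k ≠ u} // k ≠ ⟨i, hu.symm⟩} where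
  toFun k := ⟨⟨k, fun h => k.2 (Subtype.ext h)⟩, fun h => k.1.2 (congrArg Subtype.val h)⟩
  invFun k := ⟨⟨k, fun h => k.2 (Subtype.ext h)⟩, fun h => k.1.2 (congrArg Subtype.val h)⟩
  left_inv _ := rfl
  right_inv _ := rfl

/-- Summing over ordered pairs of distinct indices does not depend on the order of summation. -/
theorem sum_sum_subtype_ne_comm {ι R : Type*} [Fintype ι] [DecidableEq ι] [AddCommMonoid R]
    (f : ∀ i : ι, {u : ι // u ≠ i} → R) :
    ∑ i, ∑ u, f i u = ∑ u, ∑ i : {i : ι // i ≠ u}, f i ⟨u, i.2.symm⟩ := by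
  rw [← Fintype.sum_sigma', ← Fintype.sum_sigma']
  exact Fintype.sum_equiv
    { toFun := fun p => ⟨p.2, ⟨p.1, p.2.2.symm⟩⟩
      invFun := fun p => ⟨p.2, ⟨p.1, p.2.2.symm⟩⟩
      left_inv := fun _ => rfl
      right_inv := fun _ => rfl } _ _ fun _ => rfl

/-- The derivative of the second immanant of a polynomial matrix whose entrywise derivative is
the identity. -/
theorem derivative_d2_of_map_derivative_eq_one {ι R : Type*} [Fintype ι] [DecidableEq ι]
    [CommRing R] (M : Matrix ι ι R[X]) (hM : M.map derivative = 1) :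
    derivative (d2 M)
      = (∑ u, (M.submatrix (fun k : {k : ι // k ≠ u} => (k : ι))
            (fun k : {k : ι // k ≠ u} => (k : ι))).det)
        + ∑ u, d2 (M.submatrix (fun k : {k : ι // k ≠ u} => (k : ι))
            (fun k : {k : ι // k ≠ u} => (k : ι))) := by
  have hsub (i : ι) : (M.submatrix (fun k : {k : ι // k ≠ i} => (k : ι))
      (fun k : {k : ι // k ≠ i} => (k : ι))).map derivative = 1 := by
    rw [← submatrix_map, hM]
    exact submatrix_one _ Subtype.val_injective
  have hdiag (i : ι) : derivative (M i i) = 1 := by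
    simpa using congrFun₂ hM i i
  simp_rw [d2, derivative_sub, derivative_sum, derivative_mul, hdiag, one_mul,
    derivative_det_of_map_derivative_eq_one _ (hsub _),
    derivative_det_of_map_derivative_eq_one _ hM, Finset.sum_add_distrib,
    Finset.sum_sub_distrib, Finset.mul_sum]
  rw [sum_sum_subtype_ne_comm, add_sub_assoc]
  refine congrArg (_ + ·) (congrArg (· - _) ?_)
  refine Finset.sum_congr rfl fun u _ => Finset.sum_congr rfl fun i _ => ?_
  rw [← det_submatrix_equiv_self (deleteTwoEquiv (i : ι) u i.2.symm)]
  rfl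

theorem map_derivative_gMat (η α : ℝ) {n : ℕ} (A : Matrix (Fin n) (Fin n) ℝ) :
    (gMat η α A).map derivative = 1 := by
  ext1 i j
  by_cases h : i = j
  · subst h
    simp [gMat]
  · simp [gMat, h]

/-- Let `A` be the adjacency matrix of a loopless digraph on `n` vertices
(an `n × n` real 0-1 matrix with zero diagonal), `D` its in-degree diagonal matrix, and fix
`η ∈ {0,1}`, `α ∈ {-1,1}`. With `g(x) = d₂(x Iₙ - η D - α A)`, the derivative of `g`
satisfies `g'(x) = Σ_u det[(x Iₙ - η D - α A)_u^u] + Σ_u d₂[(x Iₙ - η D - α A)_u^u]`. -/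
theorem derivative_gPoly {n : ℕ} (A : Matrix (Fin n) (Fin n) ℝ)
    (hA : ∀ i j, A i j = 0 ∨ A i j = 1) (hdiag : ∀ i, A i i = 0)
    (η α : ℝ) (hη : η = 0 ∨ η = 1) (hα : α = -1 ∨ α = 1) :
    Polynomial.derivative (gPoly η α A)
      = (∑ u : Fin n,
          ((gMat η α A).submatrix (fun k : {k : Fin n // k ≠ u} => (k : Fin n))
            (fun k : {k : Fin n // k ≠ u} => (k : Fin n))).det)
        + ∑ u : Fin n,
          d2 ((gMat η α A).submatrix (fun k : {k : Fin n // k ≠ u} => (k : Fin n))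
            (fun k : {k : Fin n // k ≠ u} => (k : Fin n))) := by
  exact derivative_d2_of_map_derivative_eq_one _ (map_derivative_gMat η α A)
end

section
/- Let A be the adjacency matrix of a loopless digraph G⃗ on n vertices with m arcs (an n×n real 0-1 matrix with zero diagonal, with exactly m entries equal to 1), let D be the diagonal matrix of in-degrees d⁻(v_j) = Σ_i A_{ij}, and fix η ∈ {0,1} and α ∈ {−1,1}. Let g(G⃗;x) = d₂(xIₙ − ηD − αA). For an arc e⃗ = (v_s, v_t) (i.e., A_{st} = 1), let G⃗ − e⃗ be the digraph with adjacency matrix A' obtained from A by setting the (s,t) entry to 0, and in-degree diagonal matrix D' (so D' equals D with the t-th diagonal entry decreased by 1), and set g(G⃗ − e⃗; x) = d₂(xIₙ − ηD' − αA'). Then (m − n)·g(G⃗;x) + x·g'(G⃗;x) = Σ_{e⃗ ∈ E(G⃗)} g(G⃗ − e⃗; x). -/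
open Matrix Finset Polynomial

/-- The adjacency matrix of `G⃗ - e⃗`, where `e⃗ = (v_s, v_t)`: the `(s,t)` entry of `A` is
set to `0`. -/
def delArc {n : ℕ} (A : Matrix (Fin n) (Fin n) ℝ) (s t : Fin n) :
    Matrix (Fin n) (Fin n) ℝ :=
  Matrix.of fun i j => if i = s ∧ j = t then 0 else A i j

/-- The product of the diagonal entry `M i i` with the complementary principal minor is the part
of the Leibniz expansion of `det M` supported on the permutations fixing `i`. -/
theorem diag_mul_det_submatrix_ne {ι R : Type*} [Fintype ι] [DecidableEq ι] [CommRing R]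
    (M : Matrix ι ι R) (i : ι) :
    M i i * (M.submatrix (fun k : {k : ι // k ≠ i} => (k : ι))
      (fun k : {k : ι // k ≠ i} => (k : ι))).det
      = ∑ σ : Equiv.Perm ι,
          (if σ i = i then ((Equiv.Perm.sign σ : ℤ) : R) else 0) * ∏ k, M (σ k) k := by
  let N : Matrix ι ι R := M.updateCol i (Pi.single i (M i i))
  have hentry : (N.toSquareBlockProp fun k => k = i) ⟨i, rfl⟩ ⟨i, rfl⟩ = M i i := by
    simp [N, Matrix.toSquareBlockProp]
  have hminor : (N.toSquareBlockProp fun k => ¬ k = i)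
      = M.submatrix (fun k : {k : ι // k ≠ i} => (k : ι))
        (fun k : {k : ι // k ≠ i} => (k : ι)) := by
    ext r k
    simp [N, Matrix.toSquareBlockProp, k.2]
  have hblock : N.det = M i i * (M.submatrix (fun k : {k : ι // k ≠ i} => (k : ι))
      (fun k : {k : ι // k ≠ i} => (k : ι))).det := by
    rw [← hminor, ← hentry]
    convert Matrix.twoBlockTriangular_det N (fun k => k = i) ?_ using 2
    · convert (Matrix.det_eq_elem_of_subsingleton (N.toSquareBlockProp fun k => k = i) _).symm
    · rintro r hr _ rfl
      simp [N, hr]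
  rw [← hblock, Matrix.det_apply']
  refine Finset.sum_congr rfl fun σ _ => ?_
  split_ifs with h
  · congr 1
    refine Finset.prod_congr rfl fun k _ => ?_
    by_cases hk : k = i
    · subst hk
      simp [N, h]
    · simp [N, hk]
  · rw [Finset.prod_eq_zero (Finset.mem_univ i) (by simp [N, h]), mul_zero, zero_mul]

/-- The second immanant as a sum over permutations, with the character values
`sign σ * (#fixed points of σ - 1)` as coefficients. -/
theorem d2_eq_sum_perm {ι R : Type*} [Fintype ι] [DecidableEq ι] [CommRing R]
    (M : Matrix ι ι R) :
    d2 M = ∑ σ : Equiv.Perm ι,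
      (((∑ i, if σ i = i then (Equiv.Perm.sign σ : ℤ) else 0) - (Equiv.Perm.sign σ : ℤ) : ℤ) : R)
        * ∏ k, M (σ k) k := by
  unfold d2
  simp_rw [diag_mul_det_submatrix_ne]
  rw [Finset.sum_comm, Matrix.det_apply', ← Finset.sum_sub_distrib]
  refine Finset.sum_congr rfl fun σ _ => ?_
  rw [← Finset.sum_mul, ← sub_mul]
  push_cast
  rfl

theorem gMat_apply (η α : ℝ) {n : ℕ} (A : Matrix (Fin n) (Fin n) ℝ) (r k : Fin n) :
    gMat η α A r k = (if r = k then X - C (η * ∑ i, A i k) else 0) - C (α * A r k) := by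
  by_cases h : r = k
  · subst h
    simp [gMat]
  · simp [gMat, h]

theorem sum_delArc {n : ℕ} (A : Matrix (Fin n) (Fin n) ℝ) (s t k : Fin n) :
    ∑ i, delArc A s t i k = (∑ i, A i k) - if k = t then A s t else 0 := by
  have h (i : Fin n) :
      delArc A s t i k = A i k - if i = s then (if k = t then A s t else 0) else 0 := by
    by_cases hi : i = s <;> by_cases hk : k = t <;> simp [delArc, hi, hk]
  simp_rw [h, Finset.sum_sub_distrib]
  simp

/-- Deleting the arc `(s, t)` changes only column `t` of `gMat`. -/
theorem gMat_delArc_apply (η α : ℝ) {n : ℕ} (A : Matrix (Fin n) (Fin n) ℝ) (s t r k : Fin n) :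
    gMat η α (delArc A s t) r k = gMat η α A r k + if k = t then
      C (A s t) * ((if r = t then C η else 0) + if r = s then C α else 0) else 0 := by
  rw [gMat_apply, gMat_apply, sum_delArc]
  by_cases hk : k = t
  · subst hk
    by_cases hr : r = k <;> by_cases hs : r = s <;>
      simp [delArc, hr, hs] <;> (try subst hr) <;> (try subst hs) <;> simp_all <;> ring
  · simp [delArc, hk]

theorem derivative_gMat_apply (η α : ℝ) {n : ℕ} (A : Matrix (Fin n) (Fin n) ℝ) (r k : Fin n) :
    derivative (gMat η α A r k) = if r = k then 1 else 0 := by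
  rw [gMat_apply]
  split_ifs <;> simp

/-- The total change of column `t` of `gMat` over all arc deletions is `X • eₜ` minus that
column. -/
theorem sum_gMat_change (η α : ℝ) {n : ℕ} (A : Matrix (Fin n) (Fin n) ℝ) (r t : Fin n) :
    ∑ s, C (A s t) * ((if r = t then C η else 0) + if r = s then C α else 0)
      = (if r = t then X else 0) - gMat η α A r t := by
  simp_rw [mul_add, Finset.sum_add_distrib, ← Finset.sum_mul]
  rw [gMat_apply]
  by_cases h : r = t <;> simp [h] <;> ring

theorem Finset.prod_add_ite_eq {ι R : Type*} [Fintype ι] [DecidableEq ι] [CommSemiring R]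
    (f : ι → R) (b : R) (t : ι) :
    ∏ k, (f k + if k = t then b else 0) = ∏ k, f k + b * ∏ k ∈ Finset.univ.erase t, f k := by
  rw [← Finset.mul_prod_erase _ _ (Finset.mem_univ t), ← Finset.mul_prod_erase _ f
    (Finset.mem_univ t), if_pos rfl, ← add_mul]
  congr 1
  exact Finset.prod_congr rfl fun k hk => by simp [Finset.ne_of_mem_erase hk]

/-- The arc-deletion identity for a single product along a map `σ`. -/
theorem sum_prod_gMat_delArc (η α : ℝ) {n : ℕ} (A : Matrix (Fin n) (Fin n) ℝ)
    (hA : ∀ i j, A i j = 0 ∨ A i j = 1) (σ : Fin n → Fin n) :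
    ∑ p ∈ Finset.univ.filter (fun p : Fin n × Fin n => A p.1 p.2 = 1),
        ∏ k, gMat η α (delArc A p.1 p.2) (σ k) k
      = (((Finset.univ.filter (fun p : Fin n × Fin n => A p.1 p.2 = 1)).card : ℝ[X]) - (n : ℝ[X]))
          * ∏ k, gMat η α A (σ k) k + X * derivative (∏ k, gMat η α A (σ k) k) := by
  have hp (p : Fin n × Fin n) : ∏ k, gMat η α (delArc A p.1 p.2) (σ k) k
      = ∏ k, gMat η α A (σ k) k + C (A p.1 p.2) * ((if σ p.2 = p.2 then C η else 0)
          + if σ p.2 = p.1 then C α else 0) * ∏ k ∈ Finset.univ.erase p.2, gMat η α A (σ k) k := by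
    rw [← Finset.prod_add_ite_eq]
    refine Finset.prod_congr rfl fun k _ => ?_
    rw [gMat_delArc_apply]
    by_cases hk : k = p.2 <;> simp [hk]
  have hsum : ∑ p ∈ Finset.univ.filter (fun p : Fin n × Fin n => A p.1 p.2 = 1),
      C (A p.1 p.2) * ((if σ p.2 = p.2 then C η else 0) + if σ p.2 = p.1 then C α else 0)
        * ∏ k ∈ Finset.univ.erase p.2, gMat η α A (σ k) k
      = ∑ t, ((if σ t = t then X else 0) - gMat η α A (σ t) t)
        * ∏ k ∈ Finset.univ.erase t, gMat η α A (σ k) k := by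
    rw [Finset.sum_filter_of_ne, Fintype.sum_prod_type_right]
    · simp_rw [← Finset.sum_mul, sum_gMat_change]
    · intro p _ hne
      refine (hA p.1 p.2).resolve_left fun h0 => hne ?_
      simp [h0]
  simp_rw [hp, Finset.sum_add_distrib]
  rw [hsum, Polynomial.derivative_prod_finset]
  simp_rw [sub_mul, Finset.sum_sub_distrib, Finset.mul_prod_erase _
    (fun k => gMat η α A (σ k) k) (Finset.mem_univ _), derivative_gMat_apply, Finset.mul_sum]
  simp only [Finset.sum_const, nsmul_eq_mul, Finset.card_univ, Fintype.card_fin, ite_mul,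
    mul_ite, zero_mul, mul_zero, mul_one]
  simp only [mul_comm X]
  ring

/-- Let `A` be the adjacency matrix of a loopless digraph `G⃗` on `n` vertices
with `m` arcs, `D` its in-degree diagonal matrix, and fix `η ∈ {0,1}`, `α ∈ {-1,1}`. With
`g(G⃗;x) = d₂(x Iₙ - η D - α A)` and, for an arc `e⃗ = (v_s, v_t)`,
`g(G⃗ - e⃗; x) = d₂(x Iₙ - η D' - α A')` where `A'` is `A` with the `(s,t)` entry set to `0`
and `D'` is the in-degree diagonal matrix of `A'`, one has
`(m - n) g(G⃗;x) + x g'(G⃗;x) = Σ_{e⃗ ∈ E(G⃗)} g(G⃗ - e⃗; x)`. -/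
theorem arc_sum_gPoly {n m : ℕ} (A : Matrix (Fin n) (Fin n) ℝ)
    (hA : ∀ i j, A i j = 0 ∨ A i j = 1) (hdiag : ∀ i, A i i = 0)
    (hm : (Finset.univ.filter (fun p : Fin n × Fin n => A p.1 p.2 = 1)).card = m)
    (η α : ℝ) (hη : η = 0 ∨ η = 1) (hα : α = -1 ∨ α = 1) :
    ((m : Polynomial ℝ) - (n : Polynomial ℝ)) * gPoly η α A
        + X * Polynomial.derivative (gPoly η α A)
      = ∑ p ∈ Finset.univ.filter (fun p : Fin n × Fin n => A p.1 p.2 = 1),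
          gPoly η α (delArc A p.1 p.2) := by
  subst hm
  simp_rw [gPoly, d2_eq_sum_perm]
  rw [Finset.sum_comm, Polynomial.derivative_sum, Finset.mul_sum, Finset.mul_sum,
    ← Finset.sum_add_distrib]
  refine Finset.sum_congr rfl fun σ _ => ?_
  rw [← Finset.mul_sum, sum_prod_gMat_delArc η α A hA σ, Polynomial.derivative_mul,
    Polynomial.derivative_intCast]
  ring
end
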